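/- arXiv:1604.00787 — 2 statements merged into one kernel-verified Lean document; each statement's English description precedes it below -/
import Mathlib

section
/- Let N ≥ 1 and let H_1,…,H_N, G¹_1,…,G¹_N, G²_1,…,G²_N be 3N mutually independent random variables, each exponentially distributed with rate 1. Fix thresholds 0 ≤ ξ₁ ≤ ξ₂. Define the qualified set S = {n ∈ {1,…,N} : H_n > ξ₁ and G¹_n > ξ₁ and G²_n > ξ₁}, and define the two-stage outage event O as: S = ∅, or S ≠ ∅ and max_{n ∈ S} min(H_n, G²_n) < ξ₂. Then P(O) = Σ_{l=0}^{N} C(N,l) · (1 − e^{−2(ξ₂−ξ₁)})^l · e^{−3lξ₁} · (1 − e^{−3ξ₁})^{N−l}. -/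
open MeasureTheory ProbabilityTheory

lemma expMeasure_noAtom (x : ℝ) : expMeasure 1 {x} = 0 := by
  have : expMeasure 1 ≪ volume := withDensity_absolutelyContinuous _ _
  exact this (by simp)

lemma expMeasure_Ioi {x : ℝ} (hx : 0 ≤ x) :
    (expMeasure 1) (Set.Ioi x) = ENNReal.ofReal (Real.exp (-x)) := by
  have : IsProbabilityMeasure (expMeasure 1) := isProbabilityMeasure_expMeasure one_pos
  have h1 := cdf_expMeasure_eq (r := 1) one_pos x
  rw [cdf_eq_real, if_pos hx, one_mul] at h1
  have h2 : (expMeasure 1).real (Set.Ioi x) = Real.exp (-x) := by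
    rw [← Set.compl_Iic, probReal_compl_eq_one_sub measurableSet_Iic, h1]; ring
  rw [← h2, measureReal_def, ENNReal.ofReal_toReal (measure_ne_top _ _)]

lemma expMeasure_both {x y : ℝ} (hx : 0 ≤ x) (hxy : x ≤ y) :
    (expMeasure 1) (Set.Ioi x ∩ Set.Ici y) = ENNReal.ofReal (Real.exp (-y)) := by
  rw [← expMeasure_Ioi (hx.trans hxy)]
  apply le_antisymm
  · calc _ ≤ (expMeasure 1) (Set.Ioi y ∪ {y}) := measure_mono (by
          rintro z ⟨_, h⟩
          rcases eq_or_lt_of_le (show y ≤ z from h) with h | h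
          · right; exact h.symm
          · left; exact h)
      _ ≤ _ := measure_union_le _ _
      _ = _ := by rw [expMeasure_noAtom, add_zero]
  · apply measure_mono
    intro z hz
    exact ⟨lt_of_le_of_lt hxy hz, Set.mem_Ici.2 (le_of_lt (Set.mem_Ioi.1 hz))⟩

open scoped Classical in
/-- Lemma 1 of the paper: the outage probability of the two-stage
relay selection scheme. The qualified set `S(ω)` consists of the relays whose three
rate-1 exponential channel gains all exceed `ξ₁`; the outage event is `S = ∅`, or
`S ≠ ∅` and the maximum over `S` of `min (H n) (G2 n)` is below `ξ₂`. -/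
theorem twoStage_outage_prob
    {Ω : Type*} [MeasurableSpace Ω] (μ : Measure Ω) [IsProbabilityMeasure μ]
    (N : ℕ) (hN : 1 ≤ N)
    (H G1 G2 : Fin N → Ω → ℝ)
    (hHm : ∀ n, Measurable (H n)) (hG1m : ∀ n, Measurable (G1 n))
    (hG2m : ∀ n, Measurable (G2 n))
    (hIndep : iIndepFun
      (fun p : Fin N × Fin 3 => ![H p.1, G1 p.1, G2 p.1] p.2) μ)
    (hH : ∀ n, μ.map (H n) = expMeasure 1)
    (hG1 : ∀ n, μ.map (G1 n) = expMeasure 1)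
    (hG2 : ∀ n, μ.map (G2 n) = expMeasure 1)
    (ξ₁ ξ₂ : ℝ) (hξ₁ : 0 ≤ ξ₁) (hξ₁₂ : ξ₁ ≤ ξ₂) :
    (μ {ω | (Finset.univ.filter
          (fun n : Fin N => ξ₁ < H n ω ∧ ξ₁ < G1 n ω ∧ ξ₁ < G2 n ω)) = ∅ ∨
        ∃ hne : (Finset.univ.filter
            (fun n : Fin N => ξ₁ < H n ω ∧ ξ₁ < G1 n ω ∧ ξ₁ < G2 n ω)).Nonempty,
          (Finset.univ.filter
            (fun n : Fin N => ξ₁ < H n ω ∧ ξ₁ < G1 n ω ∧ ξ₁ < G2 n ω)).sup' hne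
              (fun n => min (H n ω) (G2 n ω)) < ξ₂}).toReal
      = ∑ l ∈ Finset.range (N + 1), (N.choose l : ℝ)
          * (1 - Real.exp (-2 * (ξ₂ - ξ₁))) ^ l
          * Real.exp (-3 * l * ξ₁)
          * (1 - Real.exp (-3 * ξ₁)) ^ (N - l) := by
  classical
  set f : Fin N × Fin 3 → Ω → ℝ := fun p => ![H p.1, G1 p.1, G2 p.1] p.2 with hf
  let T : Fin 3 → Set ℝ := ![Set.Ioi ξ₁ ∩ Set.Ici ξ₂, Set.Ioi ξ₁, Set.Ioi ξ₁ ∩ Set.Ici ξ₂]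
  have hT : ∀ k, MeasurableSet (T k) := by
    intro k
    fin_cases k
    · exact measurableSet_Ioi.inter measurableSet_Ici
    · exact measurableSet_Ioi
    · exact measurableSet_Ioi.inter measurableSet_Ici
  have hfm : ∀ p, Measurable (f p) := by
    rintro ⟨n, k⟩
    fin_cases k
    · exact hHm n
    · exact hG1m n
    · exact hG2m n
  let A : Fin N → Set Ω := fun n => ⋂ k, f (n, k) ⁻¹' T k
  have hAm : ∀ n, MeasurableSet (A n) := fun n =>
    MeasurableSet.iInter fun k => hfm _ (hT k)
  have hprod : ∀ s : Finset (Fin N), μ (⋂ n ∈ s, A n)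
      = ∏ n ∈ s, ∏ k, μ (f (n, k) ⁻¹' T k) := by
    intro s
    have h := hIndep.measure_inter_preimage_eq_mul (s ×ˢ Finset.univ)
      (sets := fun p => T p.2) (fun p _ => hT p.2)
    rw [Finset.prod_product] at h
    rw [← h]
    congr 1
    ext ω
    simp only [A, Set.mem_iInter, Finset.mem_product, Finset.mem_univ, and_true, Prod.forall]
    exact ⟨fun h a b ha => h a ha b, fun h a ha b => h a b ha⟩
  have hA1 : ∀ n, μ (A n) = ∏ k, μ (f (n, k) ⁻¹' T k) := by
    intro n
    simpa using hprod {n}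
  have hset : iIndepSet A μ := by
    rw [iIndepSet_iff_meas_biInter hAm]
    intro s
    rw [hprod s]
    exact Finset.prod_congr rfl fun n _ => (hA1 n).symm
  have hcompl : μ (⋂ n, (A n)ᶜ) = ∏ n, μ (A n)ᶜ := by
    have h := (iIndepSet_iff A μ).1 hset Finset.univ (f := fun n => (A n)ᶜ)
      (fun n _ => (MeasurableSpace.measurableSet_generateFrom (Set.mem_singleton _)).compl)
    simpa using h
  have hval : ∀ n, μ.real (A n) = Real.exp (-(2 * ξ₂ + ξ₁)) := by
    intro n
    have e0 : μ (f (n, 0) ⁻¹' T 0) = ENNReal.ofReal (Real.exp (-ξ₂)) := by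
      rw [← expMeasure_both hξ₁ hξ₁₂, ← hH n]
      exact (Measure.map_apply (hHm n) (hT 0)).symm
    have e1 : μ (f (n, 1) ⁻¹' T 1) = ENNReal.ofReal (Real.exp (-ξ₁)) := by
      rw [← expMeasure_Ioi hξ₁, ← hG1 n]
      exact (Measure.map_apply (hG1m n) (hT 1)).symm
    have e2 : μ (f (n, 2) ⁻¹' T 2) = ENNReal.ofReal (Real.exp (-ξ₂)) := by
      rw [← expMeasure_both hξ₁ hξ₁₂, ← hG2 n]
      exact (Measure.map_apply (hG2m n) (hT 2)).symm
    rw [measureReal_def, hA1, Fin.prod_univ_three, e0, e1, e2, ENNReal.toReal_mul,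
      ENNReal.toReal_mul, ENNReal.toReal_ofReal (Real.exp_pos _).le,
      ENNReal.toReal_ofReal (Real.exp_pos _).le, ← Real.exp_add, ← Real.exp_add]
    congr 1; ring
  have hev : {ω | (Finset.univ.filter
          (fun n : Fin N => ξ₁ < H n ω ∧ ξ₁ < G1 n ω ∧ ξ₁ < G2 n ω)) = ∅ ∨
        ∃ hne : (Finset.univ.filter
            (fun n : Fin N => ξ₁ < H n ω ∧ ξ₁ < G1 n ω ∧ ξ₁ < G2 n ω)).Nonempty,
          (Finset.univ.filter
            (fun n : Fin N => ξ₁ < H n ω ∧ ξ₁ < G1 n ω ∧ ξ₁ < G2 n ω)).sup' hne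
              (fun n => min (H n ω) (G2 n ω)) < ξ₂} = ⋂ n, (A n)ᶜ := by
    ext ω
    have hmem : ∀ n, ω ∈ A n ↔ (ξ₁ < H n ω ∧ ξ₂ ≤ H n ω) ∧ ξ₁ < G1 n ω ∧
        (ξ₁ < G2 n ω ∧ ξ₂ ≤ G2 n ω) := by
      intro n
      simp only [A, Set.mem_iInter, Fin.forall_fin_succ]
      simp [f, T]
    simp only [Set.mem_ofPred_eq, Set.mem_iInter, Set.mem_compl_iff, hmem]
    constructor
    · rintro h n ⟨⟨a, b⟩, c, d, e⟩
      have hn : n ∈ Finset.univ.filter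
          (fun n : Fin N => ξ₁ < H n ω ∧ ξ₁ < G1 n ω ∧ ξ₁ < G2 n ω) := by
        simp [a, c, d]
      rcases h with h | ⟨hne, h⟩
      · rw [h] at hn; simp at hn
      · rw [Finset.sup'_lt_iff] at h
        exact absurd (h n hn) (not_lt.2 (le_min b e))
    · intro h
      rcases Finset.eq_empty_or_nonempty (Finset.univ.filter
          (fun n : Fin N => ξ₁ < H n ω ∧ ξ₁ < G1 n ω ∧ ξ₁ < G2 n ω)) with h0 | h0
      · exact Or.inl h0
      · refine Or.inr ⟨h0, ?_⟩
        rw [Finset.sup'_lt_iff]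
        intro n hn
        obtain ⟨a, c, d⟩ := (Finset.mem_filter.1 hn).2
        by_contra hc
        obtain ⟨b, e⟩ := le_min_iff.1 (not_lt.1 hc)
        exact h n ⟨⟨a, b⟩, c, d, e⟩
  rw [hev, hcompl, ENNReal.toReal_prod]
  have hc : ∀ n, (μ (A n)ᶜ).toReal = 1 - Real.exp (-(2 * ξ₂ + ξ₁)) := by
    intro n
    rw [← measureReal_def, probReal_compl_eq_one_sub (hAm n), hval]
  simp only [hc, Finset.prod_const, Finset.card_univ, Fintype.card_fin]
  have key : 1 - Real.exp (-(2 * ξ₂ + ξ₁)) =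
      (1 - Real.exp (-2 * (ξ₂ - ξ₁))) * Real.exp (-3 * ξ₁) + (1 - Real.exp (-3 * ξ₁)) := by
    have : Real.exp (-(2 * ξ₂ + ξ₁)) = Real.exp (-2 * (ξ₂ - ξ₁)) * Real.exp (-3 * ξ₁) := by
      rw [← Real.exp_add]; congr 1; ring
    rw [this]; ring
  rw [key, add_pow]
  refine Finset.sum_congr rfl fun l _ => ?_
  have : Real.exp (-3 * l * ξ₁) = Real.exp (-3 * ξ₁) ^ l := by
    rw [← Real.exp_nat_mul]; congr 1; ring
  rw [this, mul_pow]; ring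
end

section
/- Let N ≥ 1 and let H_1,…,H_N, G¹_1,…,G¹_N, G²_1,…,G²_N be 3N mutually independent rate-1 exponential random variables on a probability space, and fix 0 ≤ ξ₁ ≤ ξ₂. For a relay index n, say outage occurs under n if not (H_n > ξ₁ and G¹_n > ξ₁ and G²_n > ξ₁) or min(H_n, G²_n) < ξ₂. Let S = {n : H_n > ξ₁, G¹_n > ξ₁, G²_n > ξ₁} and let O* be the event that S = ∅ or outage occurs under some relay n* ∈ S maximizing min(H_n, G²_n) over S. Then for every measurable relay-selection rule σ (a measurable function of the 3N channel gains taking values in {1,…,N}), P(O*) ≤ P(outage occurs under σ). -/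
open MeasureTheory ProbabilityTheory

/-- Lemma 2 of the paper: the two-stage relay selection scheme
achieves the minimal outage probability among all measurable relay-selection
rules `σ` of the `3N` channel gains.  Here `O*` is the event that the qualified
set `S = {n : H n > ξ₁, G1 n > ξ₁, G2 n > ξ₁}` is empty, or outage occurs under
some relay of `S` maximizing `min (H n) (G2 n)` over `S`; outage under a relay
`n` means `n` is unqualified or `min (H n) (G2 n) < ξ₂`. -/
theorem twoStage_outage_minimal
    {Ω : Type*} [MeasurableSpace Ω] (μ : Measure Ω) [IsProbabilityMeasure μ]
    (N : ℕ) (hN : 1 ≤ N)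
    (H G1 G2 : Fin N → Ω → ℝ)
    (hHm : ∀ n, Measurable (H n)) (hG1m : ∀ n, Measurable (G1 n))
    (hG2m : ∀ n, Measurable (G2 n))
    (hIndep : iIndepFun
      (fun p : Fin N × Fin 3 => ![H p.1, G1 p.1, G2 p.1] p.2) μ)
    (hH : ∀ n, μ.map (H n) = expMeasure 1)
    (hG1 : ∀ n, μ.map (G1 n) = expMeasure 1)
    (hG2 : ∀ n, μ.map (G2 n) = expMeasure 1)
    (ξ₁ ξ₂ : ℝ) (hξ₁ : 0 ≤ ξ₁) (hξ₁₂ : ξ₁ ≤ ξ₂)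
    (σ : (Fin N → ℝ) × (Fin N → ℝ) × (Fin N → ℝ) → Fin N)
    (hσ : Measurable σ) :
    μ {ω | (∀ n : Fin N, ¬(ξ₁ < H n ω ∧ ξ₁ < G1 n ω ∧ ξ₁ < G2 n ω)) ∨
        (∃ nstar : Fin N,
          (ξ₁ < H nstar ω ∧ ξ₁ < G1 nstar ω ∧ ξ₁ < G2 nstar ω) ∧
          (∀ m : Fin N, (ξ₁ < H m ω ∧ ξ₁ < G1 m ω ∧ ξ₁ < G2 m ω) →
            min (H m ω) (G2 m ω) ≤ min (H nstar ω) (G2 nstar ω)) ∧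
          (¬(ξ₁ < H nstar ω ∧ ξ₁ < G1 nstar ω ∧ ξ₁ < G2 nstar ω) ∨
            min (H nstar ω) (G2 nstar ω) < ξ₂))}
      ≤ μ {ω | ¬(ξ₁ < H (σ (fun n => H n ω, fun n => G1 n ω, fun n => G2 n ω)) ω ∧
            ξ₁ < G1 (σ (fun n => H n ω, fun n => G1 n ω, fun n => G2 n ω)) ω ∧
            ξ₁ < G2 (σ (fun n => H n ω, fun n => G1 n ω, fun n => G2 n ω)) ω) ∨
          min (H (σ (fun n => H n ω, fun n => G1 n ω, fun n => G2 n ω)) ω)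
            (G2 (σ (fun n => H n ω, fun n => G1 n ω, fun n => G2 n ω)) ω) < ξ₂} := by
  apply measure_mono
  intro ω hω
  simp only [Set.mem_setOf_eq] at hω ⊢
  generalize σ (fun n => H n ω, fun n => G1 n ω, fun n => G2 n ω) = k
  rcases hω with h | ⟨n, hq, hmax, h⟩
  · exact Or.inl (h k)
  · by_cases hk : ξ₁ < H k ω ∧ ξ₁ < G1 k ω ∧ ξ₁ < G2 k ω
    · rcases h with h | h
      · exact absurd hq h
      · exact Or.inr (lt_of_le_of_lt (hmax k hk) h)
    · exact Or.inl hk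
end
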